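/- First inequality of the chain relating success probabilities: for quantum channels N⁰ and N¹ from A (dimension d_A) to B (dimension d_B) with Kraus operators {N_k⁰}_{k=1}^K and {N_k¹}_{k=1}^K, it holds that p_coh(N⁰, N¹) ≤ p_incunc(N⁰, N¹). -/

import Mathlib

open scoped Kronecker Matrix

/-- The ℓ²→ℓ² operator norm of a complex matrix. -/
noncomputable def opNorm {m n : Type*} [Fintype m] [Fintype n] [DecidableEq n]
    (M : Matrix m n ℂ) : ℝ :=
  ‖LinearMap.toContinuousLinearMap (Matrix.toEuclideanLin M)‖

/-- The extended adjoint `N†(P) = ∑ₖ (I ⊗ Nₖᴴ ⊗ I) P (I ⊗ Nₖ)` of a channel with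
Kraus operators `N k`, applied to a `(d_R·d_B·d_E') × (d_R·d_B)` matrix `P`. -/
noncomputable def chAdj {dA dB dR dE : ℕ} {ι : Type*} [Fintype ι]
    (N : ι → Matrix (Fin dB) (Fin dA) ℂ)
    (P : Matrix (Fin dR × Fin dB × Fin dE) (Fin dR × Fin dB) ℂ) :
    Matrix (Fin dR × Fin dA × Fin dE) (Fin dR × Fin dA) ℂ :=
  ∑ k, ((1 : Matrix (Fin dR) (Fin dR) ℂ) ⊗ₖ ((N k)ᴴ ⊗ₖ (1 : Matrix (Fin dE) (Fin dE) ℂ))) *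
    P * ((1 : Matrix (Fin dR) (Fin dR) ℂ) ⊗ₖ N k)

/-- The coherent-discrimination success probability
`p_coh(N⁰,N¹) = [ (1/2) · sup ‖ N⁰†(P⁰) + N¹†(P¹) ‖ ]²`, where the supremum is over all
positive integers `d_R, d_E'` and all matrices `P⁰, P¹` with `P⁰ᴴP⁰ + P¹ᴴP¹ = I`. -/
noncomputable def pcoh {dA dB : ℕ} {ι : Type*} [Fintype ι]
    (N0 N1 : ι → Matrix (Fin dB) (Fin dA) ℂ) : ℝ :=
  ((1/2) * sSup {x : ℝ | ∃ (dR dE : ℕ), 0 < dR ∧ 0 < dE ∧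
    ∃ P0 P1 : Matrix (Fin dR × Fin dB × Fin dE) (Fin dR × Fin dB) ℂ,
      P0ᴴ * P0 + P1ᴴ * P1 = 1 ∧ x = opNorm (chAdj N0 P0 + chAdj N1 P1)})^2
/-- The success probability of incoherent channel discrimination with uncomputing,
`p_incunc(N⁰,N¹) = (1/2) · sup ‖ (N⁰†(P⁰))† N⁰†(P⁰) + (N¹†(P¹))† N¹†(P¹) ‖`, supremum over
positive integers `d_R, d_E'` and matrices `P⁰, P¹` with `P⁰ᴴP⁰ + P¹ᴴP¹ = I`. -/
noncomputable def pincunc {dA dB : ℕ} {ι : Type*} [Fintype ι]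
    (N0 N1 : ι → Matrix (Fin dB) (Fin dA) ℂ) : ℝ :=
  (1/2) * sSup {x : ℝ | ∃ (dR dE : ℕ), 0 < dR ∧ 0 < dE ∧
    ∃ P0 P1 : Matrix (Fin dR × Fin dB × Fin dE) (Fin dR × Fin dB) ℂ,
      P0ᴴ * P0 + P1ᴴ * P1 = 1 ∧
      x = opNorm ((chAdj N0 P0)ᴴ * chAdj N0 P0 + (chAdj N1 P1)ᴴ * chAdj N1 P1)}

open scoped Matrix.Norms.L2Operator MatrixOrder ComplexOrder

theorem opNorm_eq_norm {m n : Type*} [Fintype m] [Fintype n] [DecidableEq n]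
    (M : Matrix m n ℂ) : opNorm M = ‖M‖ := by
  rw [Matrix.l2_opNorm_def]
  rfl

theorem norm_sq_le_norm_conjTranspose_mul_self_add {m n : Type*} [Fintype m] [Fintype n]
    [DecidableEq n] (A : Matrix m n ℂ) {Q : Matrix n n ℂ} (hQ : Q.PosSemidef) :
    ‖A‖ ^ 2 ≤ ‖Aᴴ * A + Q‖ := by
  rw [sq, ← Matrix.l2_opNorm_conjTranspose_mul_self]
  exact CStarAlgebra.norm_le_norm_of_nonneg_of_le (Matrix.posSemidef_conjTranspose_mul_self A).nonneg
    (le_add_of_nonneg_right hQ.nonneg)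

theorem norm_le_one_of_conjTranspose_mul_self_add_eq_one {m n : Type*} [Fintype m] [Fintype n]
    [DecidableEq n] (A : Matrix m n ℂ) {Q : Matrix n n ℂ} (hQ : Q.PosSemidef)
    (h : Aᴴ * A + Q = 1) : ‖A‖ ≤ 1 := by
  have h1 := norm_sq_le_norm_conjTranspose_mul_self_add A hQ
  have h2 : ‖(1 : Matrix n n ℂ)‖ ≤ 1 := by
    cases isEmpty_or_nonempty n
    · simp [Subsingleton.elim (1 : Matrix n n ℂ) 0]
    · exact CStarRing.norm_one.le
  rw [h] at h1
  exact (sq_le_one_iff₀ (norm_nonneg A)).mp (h1.trans h2)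

theorem norm_le_one_of_sum_conjTranspose_mul_self_eq_one {ι m n : Type*} [Fintype ι] [Fintype m]
    [Fintype n] [DecidableEq n] {A : ι → Matrix m n ℂ} (h : ∑ k, (A k)ᴴ * A k = 1) (k : ι) :
    ‖A k‖ ≤ 1 := by
  classical
  rw [← Finset.add_sum_erase _ _ (Finset.mem_univ k)] at h
  exact norm_le_one_of_conjTranspose_mul_self_add_eq_one (A k)
    (Matrix.posSemidef_sum _ fun i _ => Matrix.posSemidef_conjTranspose_mul_self (A i)) h

theorem norm_add_sq_le {m n : Type*} [Fintype m] [Fintype n] [DecidableEq n]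
    (X Y : Matrix m n ℂ) : ‖X + Y‖ ^ 2 ≤ 2 * ‖Xᴴ * X + Yᴴ * Y‖ := by
  have h := norm_sq_le_norm_conjTranspose_mul_self_add (X + Y)
    (Matrix.posSemidef_conjTranspose_mul_self (X - Y))
  have e : (X + Y)ᴴ * (X + Y) + (X - Y)ᴴ * (X - Y) = (2 : ℂ) • (Xᴴ * X + Yᴴ * Y) := by
    simp only [Matrix.conjTranspose_add, Matrix.conjTranspose_sub, Matrix.add_mul, Matrix.mul_add,
      Matrix.sub_mul, Matrix.mul_sub, two_smul]
    abel
  rw [e, norm_smul] at h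
  simpa using h

theorem one_kronecker_sum {ι l m n : Type*} [Fintype ι] [DecidableEq l] (M : ι → Matrix m n ℂ) :
    (1 : Matrix l l ℂ) ⊗ₖ (∑ k, M k) = ∑ k, (1 : Matrix l l ℂ) ⊗ₖ M k := by
  ext i j
  simp [Matrix.sum_apply, Finset.mul_sum]

theorem sum_kronecker_one {ι l m n : Type*} [Fintype ι] [DecidableEq l] (M : ι → Matrix m n ℂ) :
    (∑ k, M k) ⊗ₖ (1 : Matrix l l ℂ) = ∑ k, M k ⊗ₖ (1 : Matrix l l ℂ) := by
  ext i j
  simp [Matrix.sum_apply, Finset.sum_mul]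

theorem norm_one_kronecker_le_one {dA dB dR : ℕ} {ι : Type*} [Fintype ι]
    {N : ι → Matrix (Fin dB) (Fin dA) ℂ} (hN : ∑ k, (N k)ᴴ * N k = 1) (k : ι) :
    ‖(1 : Matrix (Fin dR) (Fin dR) ℂ) ⊗ₖ N k‖ ≤ 1 := by
  refine norm_le_one_of_sum_conjTranspose_mul_self_eq_one
    (A := fun k => (1 : Matrix (Fin dR) (Fin dR) ℂ) ⊗ₖ N k) ?_ k
  simp only [Matrix.conjTranspose_kronecker, ← Matrix.mul_kronecker_mul, Matrix.conjTranspose_one,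
    mul_one, ← one_kronecker_sum, hN, Matrix.one_kronecker_one]

theorem norm_one_kronecker_conjTranspose_kronecker_one_le_one {dA dB dR dE : ℕ} {ι : Type*}
    [Fintype ι] {N : ι → Matrix (Fin dB) (Fin dA) ℂ} (hN : ∑ k, (N k)ᴴ * N k = 1) (k : ι) :
    ‖(1 : Matrix (Fin dR) (Fin dR) ℂ) ⊗ₖ ((N k)ᴴ ⊗ₖ (1 : Matrix (Fin dE) (Fin dE) ℂ))‖ ≤ 1 := by
  rw [← Matrix.l2_opNorm_conjTranspose]
  simp only [Matrix.conjTranspose_kronecker, Matrix.conjTranspose_one,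
    Matrix.conjTranspose_conjTranspose]
  refine norm_le_one_of_sum_conjTranspose_mul_self_eq_one
    (A := fun k => (1 : Matrix (Fin dR) (Fin dR) ℂ) ⊗ₖ
      (N k ⊗ₖ (1 : Matrix (Fin dE) (Fin dE) ℂ))) ?_ k
  simp only [Matrix.conjTranspose_kronecker, ← Matrix.mul_kronecker_mul, Matrix.conjTranspose_one,
    mul_one, ← one_kronecker_sum, ← sum_kronecker_one, hN, Matrix.one_kronecker_one]

theorem norm_chAdj_le {dA dB dR dE : ℕ} {ι : Type*} [Fintype ι]
    {N : ι → Matrix (Fin dB) (Fin dA) ℂ} (hN : ∑ k, (N k)ᴴ * N k = 1)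
    {P : Matrix (Fin dR × Fin dB × Fin dE) (Fin dR × Fin dB) ℂ} (hP : ‖P‖ ≤ 1) :
    ‖chAdj N P‖ ≤ Fintype.card ι := by
  refine (norm_sum_le_of_le (f := fun k => _) (n := fun _ => (1 : ℝ)) _ fun k _ => ?_).trans_eq
    (by simp)
  refine (Matrix.l2_opNorm_mul _ _).trans (mul_le_one₀ ?_ (norm_nonneg _)
    (norm_one_kronecker_le_one hN k))
  exact (Matrix.l2_opNorm_mul _ _).trans (mul_le_one₀
    (norm_one_kronecker_conjTranspose_kronecker_one_le_one hN k) (norm_nonneg _) hP)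

/-- First inequality of the chain: `p_coh(N⁰,N¹) ≤ p_incunc(N⁰,N¹)`. -/
theorem pcoh_le_pincunc {dA dB K : ℕ} (N0 N1 : Fin K → Matrix (Fin dB) (Fin dA) ℂ)
    (hN0 : ∑ k, (N0 k)ᴴ * N0 k = 1) (hN1 : ∑ k, (N1 k)ᴴ * N1 k = 1) :
    pcoh N0 N1 ≤ pincunc N0 N1 := by
  unfold pcoh pincunc
  simp only [opNorm_eq_norm]
  set S := {x : ℝ | ∃ (dR dE : ℕ), 0 < dR ∧ 0 < dE ∧
    ∃ P0 P1 : Matrix (Fin dR × Fin dB × Fin dE) (Fin dR × Fin dB) ℂ,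
      P0ᴴ * P0 + P1ᴴ * P1 = 1 ∧ x = ‖chAdj N0 P0 + chAdj N1 P1‖}
  set T := {x : ℝ | ∃ (dR dE : ℕ), 0 < dR ∧ 0 < dE ∧
    ∃ P0 P1 : Matrix (Fin dR × Fin dB × Fin dE) (Fin dR × Fin dB) ℂ,
      P0ᴴ * P0 + P1ᴴ * P1 = 1 ∧
      x = ‖(chAdj N0 P0)ᴴ * chAdj N0 P0 + (chAdj N1 P1)ᴴ * chAdj N1 P1‖}
  have hT : BddAbove T := by
    refine ⟨K * K + K * K, ?_⟩
    rintro x ⟨dR, dE, -, -, P0, P1, hP, rfl⟩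
    have b0 := norm_chAdj_le hN0 (norm_le_one_of_conjTranspose_mul_self_add_eq_one P0
      (Matrix.posSemidef_conjTranspose_mul_self P1) hP)
    have b1 := norm_chAdj_le hN1 (norm_le_one_of_conjTranspose_mul_self_add_eq_one P1
      (Matrix.posSemidef_conjTranspose_mul_self P0) ((add_comm _ _).trans hP))
    rw [Fintype.card_fin] at b0 b1
    refine (norm_add_le _ _).trans ?_
    rw [Matrix.l2_opNorm_conjTranspose_mul_self, Matrix.l2_opNorm_conjTranspose_mul_self]
    gcongr
  have hS0 : 0 ≤ sSup S := by
    refine Real.sSup_nonneg ?_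
    rintro x ⟨dR, dE, -, -, P0, P1, -, rfl⟩
    exact norm_nonneg _
  have hT0 : 0 ≤ sSup T := by
    refine Real.sSup_nonneg ?_
    rintro x ⟨dR, dE, -, -, P0, P1, -, rfl⟩
    exact norm_nonneg _
  have hST : sSup S ≤ √(2 * sSup T) := by
    refine Real.sSup_le ?_ (Real.sqrt_nonneg _)
    rintro x ⟨dR, dE, hR, hE, P0, P1, hP, rfl⟩
    refine Real.le_sqrt_of_sq_le ((norm_add_sq_le _ _).trans ?_)
    gcongr
    exact le_csSup hT ⟨dR, dE, hR, hE, P0, P1, hP, rfl⟩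
  have h := (Real.le_sqrt hS0 (by positivity)).mp hST
  linarith [mul_pow (1 / 2) (sSup S) 2]
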